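/- If a Hermitian n×n matrix A over the split quaternion algebra H has two identical rows (or two identical columns), then det A = 0. -/

import Mathlib

/-- The split quaternion (coquaternion) algebra over ℝ:
`i² = −1`, `j² = 1`, `k² = 1`, `ij = −ji = k`. -/
abbrev SplitQuaternion : Type := QuaternionAlgebra ℝ (-1) 0 1

noncomputable section

namespace SplitQuaternion

variable {n : ℕ}

/-- The ordered product of entries of `A` along the cycle of `σ` containing `s`,
read in the "row" direction:
`a_{s, σ s} * a_{σ s, σ² s} * ⋯ * a_{σ^{L−1} s, s}` where `L` is the cycle length. -/
def rowCycleProd (A : Matrix (Fin n) (Fin n) SplitQuaternion) (σ : Equiv.Perm (Fin n))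
    (s : Fin n) : SplitQuaternion :=
  ((List.range (Function.minimalPeriod σ s)).map
    (fun m => A ((σ ^ m) s) ((σ ^ (m + 1)) s))).prod

/-- The ordered product of entries of `A` along the cycle of `σ` containing `s`,
read in the "column" direction:
`a_{s, σ^{L−1} s} * ⋯ * a_{σ² s, σ s} * a_{σ s, s}` where `L` is the cycle length. -/
def colCycleProd (A : Matrix (Fin n) (Fin n) SplitQuaternion) (σ : Equiv.Perm (Fin n))
    (s : Fin n) : SplitQuaternion :=
  (((List.range (Function.minimalPeriod σ s)).map
    (fun m => A ((σ ^ (m + 1)) s) ((σ ^ m) s))).reverse).prod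

open scoped Classical in
/-- The least elements of the cycles of `σ` other than the cycle containing `i`,
listed in increasing order. -/
def otherCycleMins (σ : Equiv.Perm (Fin n)) (i : Fin n) : List (Fin n) :=
  (Finset.univ.filter (fun s : Fin n =>
    (∀ t, σ.SameCycle s t → s ≤ t) ∧ ¬ σ.SameCycle i s)).sort (· ≤ ·)

/-- The `i`-th row determinant of `A`: the sum over all permutations `σ` of
`(−1)^{n−r}` (which is `sign σ`, `r` being the number of disjoint cycles of `σ`,
fixed points included) times the product of the entries of `A` ordered according to
the left-ordered cycle notation of `σ` whose first cycle starts with `i`, every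
other cycle starting with its least element, the cycles being ordered by
increasing least elements. -/
def rdet (A : Matrix (Fin n) (Fin n) SplitQuaternion) (i : Fin n) : SplitQuaternion :=
  ∑ σ : Equiv.Perm (Fin n),
    ((Equiv.Perm.sign σ : ℤ) : SplitQuaternion) *
      (rowCycleProd A σ i * ((otherCycleMins σ i).map (rowCycleProd A σ)).prod)

/-- The `j`-th column determinant of `A`: the sum over all permutations `τ` of
`(−1)^{n−r}` times the product of the entries of `A` ordered according to the
right-ordered cycle notation of `τ` whose rightmost cycle ends with `j`, every
other cycle ending with its least element, the cycles being ordered (from right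
to left) by increasing least elements. -/
def cdet (A : Matrix (Fin n) (Fin n) SplitQuaternion) (j : Fin n) : SplitQuaternion :=
  ∑ σ : Equiv.Perm (Fin n),
    ((Equiv.Perm.sign σ : ℤ) : SplitQuaternion) *
      ((((otherCycleMins σ j).reverse).map (colCycleProd A σ)).prod * colCycleProd A σ j)

/-- The determinant of a Hermitian matrix: the common value of all row and column
determinants (here given as `rdet` at the index `0`). -/
def hdet [NeZero n] (A : Matrix (Fin n) (Fin n) SplitQuaternion) : SplitQuaternion :=
  rdet A 0


open Equiv Function

section Perm

variable {α : Type*}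

theorem pow_apply_eq_of_forall_sameCycle {σ τ : Perm α} {t : α}
    (h : ∀ x, σ.SameCycle t x → τ x = σ x) (m : ℕ) : (τ ^ m) t = (σ ^ m) t := by
  induction m with
  | zero => rfl
  | succ m ih =>
    rw [pow_succ', Perm.mul_apply, ih, h _ ⟨m, by simp⟩, pow_succ', Perm.mul_apply]

theorem sameCycle_iff_exists_pow [Finite α] {σ : Perm α} {x y : α} :
    σ.SameCycle x y ↔ ∃ m : ℕ, (σ ^ m) x = y :=
  ⟨fun h => h.exists_nat_pow_eq, fun ⟨m, h⟩ => ⟨m, by simpa using h⟩⟩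

theorem sameCycle_iff_of_forall_pow_apply_eq [Finite α] {σ τ : Perm α} {t : α}
    (h : ∀ m : ℕ, (τ ^ m) t = (σ ^ m) t) (x : α) : τ.SameCycle t x ↔ σ.SameCycle t x := by
  simp only [sameCycle_iff_exists_pow, h]

theorem minimalPeriod_perm_pos [Finite α] (σ : Perm α) (s : α) : 0 < minimalPeriod σ s := by
  refine IsPeriodicPt.minimalPeriod_pos (orderOf_pos σ) ?_
  rw [IsPeriodicPt, IsFixedPt, Perm.iterate_eq_pow, pow_orderOf_eq_one, Perm.one_apply]

theorem pow_minimalPeriod_apply (σ : Perm α) (s : α) : (σ ^ minimalPeriod σ s) s = s := by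
  rw [← Perm.iterate_eq_pow]
  exact isPeriodicPt_minimalPeriod σ s

theorem pow_apply_ne_self {σ : Perm α} {s : α} {m : ℕ} (h₀ : 0 < m)
    (h : m < minimalPeriod σ s) : (σ ^ m) s ≠ s := by
  intro hm
  exact not_isPeriodicPt_of_pos_of_lt_minimalPeriod h₀.ne' h hm

variable [DecidableEq α]

theorem mul_swap_pow_apply {σ : Perm α} {i j : α} {b : ℕ}
    (hi : ∀ m, 0 < m → m < b → (σ ^ m) j ≠ i) (hj : ∀ m, 0 < m → m < b → (σ ^ m) j ≠ j)
    {m : ℕ} (h₀ : 0 < m) (hm : m ≤ b) : ((σ * swap i j) ^ m) i = (σ ^ m) j := by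
  induction m, h₀ using Nat.le_induction with
  | base => simp
  | succ m h₁ ih =>
    rw [pow_succ', Perm.mul_apply, ih (by omega), pow_succ' σ, Perm.mul_apply σ, Perm.mul_apply σ,
      swap_apply_of_ne_of_ne (hi m (by omega) (by omega)) (hj m (by omega) (by omega))]

theorem mul_swap_pow_apply_of_not_sameCycle_of_not_sameCycle {σ : Perm α} {i j t : α}
    (hi : ¬ σ.SameCycle i t) (hj : ¬ σ.SameCycle j t) (m : ℕ) :
    ((σ * swap i j) ^ m) t = (σ ^ m) t := by
  refine pow_apply_eq_of_forall_sameCycle (fun x hx => ?_) m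
  rw [Perm.mul_apply, swap_apply_of_ne_of_ne]
  · rintro rfl; exact hi hx.symm
  · rintro rfl; exact hj hx.symm

variable [Fintype α]

/-- The permutation obtained from `σ` by inverting the cycle through `s`. -/
def invCycle (s : α) (σ : Perm α) : Perm α :=
  σ * (σ⁻¹.cycleOf s * σ⁻¹.cycleOf s)

theorem invCycle_apply_of_sameCycle {σ : Perm α} {s x : α} (h : σ.SameCycle s x) :
    invCycle s σ x = σ⁻¹ x := by
  have h₁ : σ⁻¹.SameCycle s x := h.inv
  have h₂ : σ⁻¹.SameCycle s (σ⁻¹ x) := Perm.sameCycle_apply_right.2 h₁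
  rw [invCycle, Perm.mul_apply, Perm.mul_apply, h₁.cycleOf_apply, h₂.cycleOf_apply,
    ← Perm.mul_apply, mul_inv_cancel, Perm.one_apply]

theorem invCycle_apply_of_not_sameCycle {σ : Perm α} {s x : α} (h : ¬ σ.SameCycle s x) :
    invCycle s σ x = σ x := by
  have h₁ : ¬ σ⁻¹.SameCycle s x := fun h' => h (Perm.sameCycle_inv.1 h')
  simp [invCycle, Perm.cycleOf_apply, h₁]

theorem invCycle_pow_apply_self (σ : Perm α) (s : α) (m : ℕ) :
    (invCycle s σ ^ m) s = (σ⁻¹ ^ m) s :=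
  pow_apply_eq_of_forall_sameCycle
    (fun _ hx => invCycle_apply_of_sameCycle (Perm.sameCycle_inv.1 hx)) m

theorem invCycle_pow_apply_of_not_sameCycle {σ : Perm α} {s t : α} (h : ¬ σ.SameCycle s t)
    (m : ℕ) : (invCycle s σ ^ m) t = (σ ^ m) t :=
  pow_apply_eq_of_forall_sameCycle
    (fun _ hx => invCycle_apply_of_not_sameCycle fun h' => h (h'.trans hx.symm)) m

theorem invCycle_sameCycle_iff (σ : Perm α) (s x y : α) :
    (invCycle s σ).SameCycle x y ↔ σ.SameCycle x y := by
  have hs (z : α) : (invCycle s σ).SameCycle s z ↔ σ.SameCycle s z :=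
    (sameCycle_iff_of_forall_pow_apply_eq (invCycle_pow_apply_self σ s) z).trans
      Perm.sameCycle_inv
  by_cases h : σ.SameCycle s x
  · have h' := (hs x).2 h
    exact ⟨fun hxy => h.symm.trans ((hs y).1 (h'.trans hxy)),
      fun hxy => h'.symm.trans ((hs y).2 (h.trans hxy))⟩
  · exact sameCycle_iff_of_forall_pow_apply_eq (invCycle_pow_apply_of_not_sameCycle h) y

theorem invCycle_involutive (s : α) : Involutive (invCycle s) := by
  intro σ
  ext x
  by_cases h : σ.SameCycle s x
  · rw [invCycle_apply_of_sameCycle ((invCycle_sameCycle_iff σ s s x).2 h), Perm.inv_eq_iff_eq,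
      invCycle_apply_of_sameCycle ((Perm.sameCycle_apply_right).2 h), ← Perm.mul_apply,
      inv_mul_cancel, Perm.one_apply]
  · rw [invCycle_apply_of_not_sameCycle (mt (invCycle_sameCycle_iff σ s s x).1 h),
      invCycle_apply_of_not_sameCycle h]

theorem sign_invCycle (s : α) (σ : Perm α) : Perm.sign (invCycle s σ) = Perm.sign σ := by
  simp [invCycle, Int.units_mul_self]

theorem sum_perm_eq_zero_of_invCycle {M : Type*} [AddCommGroup M] [Module ℝ M] (s : α)
    {d : Perm α → M} (h : ∀ σ, d (invCycle s σ) = -d σ) : ∑ σ, d σ = 0 := by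
  have h₁ : ∑ σ, d (invCycle s σ) = ∑ σ, d σ :=
    Equiv.sum_comp (invCycle_involutive s).toPerm d
  simp only [h, Finset.sum_neg_distrib] at h₁
  have h₂ : (2 : ℝ) • ∑ σ, d σ = 0 := by
    rw [two_smul]
    exact eq_neg_iff_add_eq_zero.1 h₁.symm
  exact (smul_eq_zero.1 h₂).resolve_left two_ne_zero

theorem mul_swap_pow_apply_of_not_sameCycle {σ : Perm α} {i j : α} (h : ¬ σ.SameCycle i j)
    {m : ℕ} (h₀ : 0 < m) (hm : m ≤ minimalPeriod σ j) :
    ((σ * swap i j) ^ m) i = (σ ^ m) j :=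
  mul_swap_pow_apply (fun m _ _ h' => h (sameCycle_iff_exists_pow.2 ⟨m, h'⟩).symm)
    (fun _ => pow_apply_ne_self) h₀ hm

theorem mul_swap_sameCycle_of_not_sameCycle {σ : Perm α} {i j : α} (h : ¬ σ.SameCycle i j) :
    (σ * swap i j).SameCycle i j :=
  sameCycle_iff_exists_pow.2 ⟨minimalPeriod σ j, by
    rw [mul_swap_pow_apply_of_not_sameCycle h (minimalPeriod_perm_pos σ j) le_rfl,
      pow_minimalPeriod_apply]⟩

theorem not_mul_swap_sameCycle_of_sameCycle {σ : Perm α} {i j : α} (hij : i ≠ j)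
    (h : σ.SameCycle i j) : ¬ (σ * swap i j).SameCycle i j := by
  have hex : ∃ m : ℕ, (σ ^ m) j = i := h.symm.exists_nat_pow_eq
  classical
  set k := Nat.find hex
  have hki : (σ ^ k) j = i := Nat.find_spec hex
  have hmin (m : ℕ) (hm : m < k) : (σ ^ m) j ≠ i := Nat.find_min hex hm
  have hk₀ : 0 < k := by
    rcases Nat.eq_zero_or_pos k with h₀ | h₀
    · rw [h₀] at hki; exact absurd hki.symm hij
    · exact h₀
  have hj (m : ℕ) (h₀ : 0 < m) (hm : m < k) : (σ ^ m) j ≠ j := by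
    intro h'
    apply hmin (k - m) (by omega)
    rw [← hki]
    conv_rhs => rw [show k = (k - m) + m by omega, pow_add, Perm.mul_apply, h']
  have hpow {m : ℕ} (h₀ : 0 < m) (hm : m ≤ k) : ((σ * swap i j) ^ m) i = (σ ^ m) j :=
    mul_swap_pow_apply (fun m _ => hmin m) hj h₀ hm
  intro hs
  obtain ⟨m, hm⟩ := hs.exists_nat_pow_eq
  have hper : IsPeriodicPt (σ * swap i j) k i := (hpow hk₀ le_rfl).trans hki
  have hm' : ((σ * swap i j) ^ (m % k)) i = j := by
    rw [← Perm.iterate_eq_pow, hper.iterate_mod_apply, Perm.iterate_eq_pow, hm]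
  rcases Nat.eq_zero_or_pos (m % k) with h₀ | h₀
  · rw [h₀] at hm'; exact hij hm'
  · have hlt := Nat.mod_lt m hk₀
    rw [hpow h₀ hlt.le] at hm'
    exact hj _ h₀ hlt hm'

theorem minimalPeriod_mul_swap {σ : Perm α} {i j : α} (h : ¬ σ.SameCycle i j) :
    minimalPeriod (σ * swap i j : Perm α) i = minimalPeriod σ j + minimalPeriod σ i ∧
      ∀ m, 0 < m → m ≤ minimalPeriod σ i →
        ((σ * swap i j) ^ (minimalPeriod σ j + m)) i = (σ ^ m) i := by
  have hb := minimalPeriod_perm_pos σ j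
  have ha := minimalPeriod_perm_pos σ i
  have h' : ¬ σ.SameCycle j i := fun h' => h h'.symm
  have hsecond {m : ℕ} (h₀ : 0 < m) (hm : m ≤ minimalPeriod σ i) :
      ((σ * swap i j) ^ (minimalPeriod σ j + m)) i = (σ ^ m) i := by
    rw [add_comm, pow_add, Perm.mul_apply, mul_swap_pow_apply_of_not_sameCycle h hb le_rfl,
      pow_minimalPeriod_apply, swap_comm, mul_swap_pow_apply_of_not_sameCycle h' h₀ hm]
  refine ⟨le_antisymm (IsPeriodicPt.minimalPeriod_le (by omega) ?_) ?_, fun m => hsecond⟩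
  · exact (hsecond ha le_rfl).trans (pow_minimalPeriod_apply σ i)
  · by_contra! hlt
    have hp := minimalPeriod_perm_pos (σ * swap i j) i
    have hfix := pow_minimalPeriod_apply (σ * swap i j) i
    set p := minimalPeriod (σ * swap i j : Perm α) i
    by_cases hpb : p ≤ minimalPeriod σ j
    · rw [mul_swap_pow_apply_of_not_sameCycle h hp hpb] at hfix
      exact h' (sameCycle_iff_exists_pow.2 ⟨p, hfix⟩)
    · obtain ⟨m, hm⟩ : ∃ m, p = minimalPeriod σ j + m := 
        ⟨p - minimalPeriod σ j, by omega⟩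
      rw [hm, hsecond (by omega) (by omega)] at hfix
      exact pow_apply_ne_self (by omega) (by omega) hfix

theorem mul_swap_sameCycle_iff {σ : Perm α} {i j : α} (h : ¬ σ.SameCycle i j) (t : α) :
    (σ * swap i j).SameCycle i t ↔ σ.SameCycle i t ∨ σ.SameCycle j t := by
  have hij := mul_swap_sameCycle_of_not_sameCycle h
  have hstep (x : α) (hx : (σ * swap i j).SameCycle i x) :
      (σ * swap i j).SameCycle i (σ x) := by
    have : σ x = (σ * swap i j) (swap i j x) := by simp
    rw [this, Perm.sameCycle_apply_right]
    by_cases h₁ : x = i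
    · subst h₁; simpa using hij
    by_cases h₂ : x = j
    · rw [h₂, swap_apply_right]
    rwa [swap_apply_of_ne_of_ne h₁ h₂]
  have hpow (x : α) (hx : (σ * swap i j).SameCycle i x) (m : ℕ) :
      (σ * swap i j).SameCycle i ((σ ^ m) x) := by
    induction m with
    | zero => exact hx
    | succ m ih => rw [pow_succ', Perm.mul_apply]; exact hstep _ ih
  constructor
  · intro ht
    by_contra! hc
    have := (sameCycle_iff_of_forall_pow_apply_eq
      (mul_swap_pow_apply_of_not_sameCycle_of_not_sameCycle hc.1 hc.2) i).1 ht.symm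
    exact hc.1 this.symm
  · rintro (ht | ht) <;> obtain ⟨m, rfl⟩ := ht.exists_nat_pow_eq
    · exact hpow i .rfl m
    · exact hpow j hij m

end Perm

section CycleProd

variable (A : Matrix (Fin n) (Fin n) SplitQuaternion)

theorem rowCycleProd_congr {σ τ : Perm (Fin n)} {t : Fin n}
    (h : ∀ m : ℕ, (τ ^ m) t = (σ ^ m) t) : rowCycleProd A τ t = rowCycleProd A σ t := by
  have hp : minimalPeriod τ t = minimalPeriod σ t :=
    minimalPeriod_eq_minimalPeriod_iff.2 fun m => by
      simp only [IsPeriodicPt, IsFixedPt, Perm.iterate_eq_pow, h]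
  simp only [rowCycleProd, hp, h]

theorem rowCycleProd_inv (hA : A.IsHermitian) (σ : Perm (Fin n)) (s : Fin n) :
    rowCycleProd A σ⁻¹ s = star (rowCycleProd A σ s) := by
  have hp : minimalPeriod (σ⁻¹ : Perm (Fin n)) s = minimalPeriod σ s :=
    minimalPeriod_eq_minimalPeriod_iff.2 fun m => by
      simp only [IsPeriodicPt, IsFixedPt, Perm.iterate_eq_pow, inv_pow, Perm.inv_eq_iff_eq]
      exact eq_comm
  have hstar (l : List SplitQuaternion) : star l.prod = (l.reverse.map star).prod := by
    induction l with
    | nil => simp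
    | cons a l ih => simp [ih]
  rw [rowCycleProd, rowCycleProd, hp, hstar, ← List.map_reverse, List.map_map]
  congr 1
  refine List.ext_getElem (by simp) fun m h₁ h₂ => ?_
  simp only [List.length_map, List.length_range] at h₁
  have hinv (k : ℕ) (hk : k ≤ minimalPeriod σ s) :
      (σ⁻¹ ^ k) s = (σ ^ (minimalPeriod σ s - k)) s := by
    rw [inv_pow, Perm.inv_eq_iff_eq, ← Perm.mul_apply, ← pow_add, Nat.add_sub_cancel' hk,
      pow_minimalPeriod_apply]
  simp only [List.getElem_map, List.getElem_range, List.getElem_reverse, List.length_range,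
    Function.comp_apply]
  rw [hA.apply, hinv m (by omega), hinv (m + 1) (by omega)]
  congr 3 <;> omega

theorem rowCycleProd_invCycle_self (hA : A.IsHermitian) (σ : Perm (Fin n)) (s : Fin n) :
    rowCycleProd A (invCycle s σ) s = star (rowCycleProd A σ s) := by
  rw [rowCycleProd_congr A (invCycle_pow_apply_self σ s), rowCycleProd_inv A hA]

theorem re_mul_comm (x y : SplitQuaternion) : (x * y).re = (y * x).re := by
  simp; ring

theorem re_rowCycleProd_apply (σ : Perm (Fin n)) (s : Fin n) :
    (rowCycleProd A σ (σ s)).re = (rowCycleProd A σ s).re := by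
  have hp : minimalPeriod σ (σ s) = minimalPeriod σ s :=
    minimalPeriod_eq_minimalPeriod_iff.2 fun m => by
      simp only [IsPeriodicPt, IsFixedPt, Perm.iterate_eq_pow]
      rw [← Perm.mul_apply, ← pow_succ, pow_succ', Perm.mul_apply, σ.injective.eq_iff]
  obtain ⟨L, hL⟩ := Nat.exists_eq_succ_of_ne_zero (minimalPeriod_perm_pos σ s).ne'
  have hfix := pow_minimalPeriod_apply σ s
  have hshift (m : ℕ) : (σ ^ m) (σ s) = (σ ^ (m + 1)) s := by
    rw [pow_succ, Perm.mul_apply]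
  rw [hL] at hfix
  rw [rowCycleProd, rowCycleProd, hp, hL]
  simp only [hshift]
  rw [List.prod_range_succ, List.prod_range_succ', re_mul_comm]
  have h₁ : (σ ^ (L + 1 + 1)) s = (σ ^ (0 + 1)) s := by
    rw [add_comm (L + 1) 1, pow_add, Perm.mul_apply, hfix, zero_add]
  rw [h₁, show L + 1 = L.succ from rfl, hfix, pow_zero, Perm.one_apply]

theorem re_rowCycleProd_of_sameCycle {σ : Perm (Fin n)} {s t : Fin n} (h : σ.SameCycle s t) :
    (rowCycleProd A σ t).re = (rowCycleProd A σ s).re := by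
  obtain ⟨m, rfl⟩ := h.exists_nat_pow_eq
  induction m with
  | zero => rfl
  | succ m ih =>
    rw [pow_succ', Perm.mul_apply, re_rowCycleProd_apply]
    exact ih (sameCycle_iff_exists_pow.2 ⟨m, rfl⟩)

theorem rowCycleProd_mul_swap {i j : Fin n} (hrow : ∀ q, A i q = A j q) {σ : Perm (Fin n)}
    (h : ¬ σ.SameCycle i j) :
    rowCycleProd A (σ * swap i j) i = rowCycleProd A σ j * rowCycleProd A σ i := by
  obtain ⟨hp, hsecond⟩ := minimalPeriod_mul_swap h
  have hb := minimalPeriod_perm_pos σ j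
  have hA (m : ℕ) (k : Fin n) (hm : m < minimalPeriod σ j) :
      A (((σ * swap i j) ^ m) i) k = A ((σ ^ m) j) k := by
    rcases Nat.eq_zero_or_pos m with rfl | h₀
    · simpa using hrow k
    · rw [mul_swap_pow_apply_of_not_sameCycle h h₀ hm.le]
  have hA' (m : ℕ) (k : Fin n) (hm : m < minimalPeriod σ i) :
      A (((σ * swap i j) ^ (minimalPeriod σ j + m)) i) k = A ((σ ^ m) i) k := by
    rcases Nat.eq_zero_or_pos m with rfl | h₀
    · rw [add_zero, mul_swap_pow_apply_of_not_sameCycle h hb le_rfl, pow_minimalPeriod_apply]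
      simpa using (hrow k).symm
    · rw [hsecond m h₀ hm.le]
  rw [rowCycleProd, hp, List.range_add, List.map_append, List.prod_append, List.map_map]
  congr 2 <;> refine List.map_congr_left fun m hm => ?_ <;> rw [List.mem_range] at hm
  · rw [hA m _ hm, mul_swap_pow_apply_of_not_sameCycle h (by omega) (by omega)]
  · rw [Function.comp_apply, hA' m _ hm, add_assoc, hsecond (m + 1) (by omega) (by omega)]

end CycleProd

open scoped Classical in
/-- The least elements of the cycles of `σ`. -/
def cycleMins (σ : Perm (Fin n)) : Finset (Fin n) :=
  Finset.univ.filter fun s => ∀ t, σ.SameCycle s t → s ≤ t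

theorem mem_cycleMins {σ : Perm (Fin n)} {s : Fin n} :
    s ∈ cycleMins σ ↔ ∀ t, σ.SameCycle s t → s ≤ t := by
  simp [cycleMins]

theorem mem_otherCycleMins {σ : Perm (Fin n)} {i s : Fin n} :
    s ∈ otherCycleMins σ i ↔ s ∈ cycleMins σ ∧ ¬ σ.SameCycle i s := by
  simp [otherCycleMins, mem_cycleMins]

open scoped Classical in
theorem prod_cycleMins_filter {M : Type*} [CommMonoid M] {σ : Perm (Fin n)} {R : Fin n → M}
    (hR : ∀ s t, σ.SameCycle s t → R t = R s) {Q : Fin n → Prop}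
    (hQ : ∀ s t, σ.SameCycle s t → Q s → Q t) {i : Fin n} (hi : Q i) :
    ∏ t ∈ cycleMins σ with Q t, R t =
      R i * ∏ t ∈ cycleMins σ with Q t ∧ ¬ σ.SameCycle i t, R t := by
  have hne : (Finset.univ.filter fun t => σ.SameCycle i t).Nonempty := ⟨i, by simp [Perm.SameCycle.refl]⟩
  obtain ⟨k, hk, hmin⟩ := Finset.exists_min_image _ id hne
  simp only [Finset.mem_filter, Finset.mem_univ, true_and, id] at hk hmin
  have hkmem : k ∈ cycleMins σ := mem_cycleMins.2 fun t ht => hmin t (hk.trans ht)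
  rw [← hR i k hk, ← Finset.mul_prod_erase _ R (Finset.mem_filter.2 ⟨hkmem, hQ i k hk hi⟩)]
  congr 2
  ext t
  simp only [Finset.mem_erase, Finset.mem_filter]
  constructor
  · rintro ⟨hne, ht, hq⟩
    refine ⟨ht, hq, fun hit => hne ?_⟩
    exact le_antisymm (mem_cycleMins.1 ht k (hit.symm.trans hk)) (hmin t hit)
  · rintro ⟨ht, hq, hit⟩
    exact ⟨fun h => hit (h ▸ hk), ht, hq⟩

section RealPart

variable (A : Matrix (Fin n) (Fin n) SplitQuaternion)

/-- The product over the cycles of `σ` of the real parts of the cycle products. -/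
def cycleReProd (σ : Perm (Fin n)) : ℝ :=
  ∏ t ∈ cycleMins σ, (rowCycleProd A σ t).re

open scoped Classical in
theorem cycleReProd_eq_mul (σ : Perm (Fin n)) (i : Fin n) :
    cycleReProd A σ = (rowCycleProd A σ i).re *
      ∏ t ∈ cycleMins σ with ¬ σ.SameCycle i t, (rowCycleProd A σ t).re := by
  simpa only [cycleReProd, Finset.filter_true, true_and] using
    prod_cycleMins_filter (σ := σ) (fun s t h => re_rowCycleProd_of_sameCycle A h)
      (Q := fun _ => True) (fun _ _ _ _ => trivial) (i := i) trivial

/-- The representatives of all cycles of `σ`, starting with `i`. -/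
def cycleReps (i : Fin n) (σ : Perm (Fin n)) : List (Fin n) :=
  i :: otherCycleMins σ i

theorem cycleReps_invCycle (i s : Fin n) (σ : Perm (Fin n)) :
    cycleReps i (invCycle s σ) = cycleReps i σ := by
  simp only [cycleReps, otherCycleMins, invCycle_sameCycle_iff]

theorem nodup_otherCycleMins (i : Fin n) (σ : Perm (Fin n)) : (otherCycleMins σ i).Nodup :=
  Finset.sort_nodup _ _

theorem nodup_cycleReps (i : Fin n) (σ : Perm (Fin n)) : (cycleReps i σ).Nodup :=
  List.nodup_cons.2 ⟨fun h => (mem_otherCycleMins.1 h).2 .rfl, nodup_otherCycleMins i σ⟩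

theorem eq_of_mem_cycleReps {i s t : Fin n} {σ : Perm (Fin n)} (hs : s ∈ cycleReps i σ)
    (ht : t ∈ cycleReps i σ) (h : σ.SameCycle s t) : s = t := by
  simp only [cycleReps, List.mem_cons, mem_otherCycleMins, mem_cycleMins] at hs ht
  rcases hs with rfl | ⟨hs, hs'⟩ <;> rcases ht with rfl | ⟨ht, ht'⟩
  · rfl
  · exact absurd h ht'
  · exact absurd h.symm hs'
  · exact le_antisymm (hs _ h) (ht _ h.symm)

theorem list_prod_map_sub_eq_neg {ι R : Type*} [Ring R] {l : List ι} (hl : l.Nodup) {k : ι}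
    {f f' g g' : ι → R} (hf : ∀ t ∈ l, t ≠ k → f' t = f t) (hg : ∀ t ∈ l, t ≠ k → g t = f t)
    (hg' : ∀ t ∈ l, t ≠ k → g' t = f t) (hk : k ∈ l → g k - g' k = -(f k - f' k)) :
    (l.map g).prod - (l.map g').prod = -((l.map f).prod - (l.map f').prod) := by
  induction l with
  | nil => simp
  | cons a l ih =>
    rw [List.nodup_cons] at hl
    simp only [List.map_cons, List.prod_cons]
    by_cases hak : a = k
    · subst hak
      have hne (t : ι) (ht : t ∈ l) : t ≠ a := by rintro rfl; exact hl.1 ht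
      have e₁ := List.map_congr_left fun t ht => hf t (List.mem_cons_of_mem _ ht) (hne t ht)
      have e₂ := List.map_congr_left fun t ht => hg t (List.mem_cons_of_mem _ ht) (hne t ht)
      have e₃ := List.map_congr_left fun t ht => hg' t (List.mem_cons_of_mem _ ht) (hne t ht)
      rw [e₁, e₂, e₃, ← sub_mul, ← sub_mul, hk List.mem_cons_self, neg_mul]
    · rw [hf a List.mem_cons_self hak, hg a List.mem_cons_self hak,
        hg' a List.mem_cons_self hak, ← mul_sub, ← mul_sub,
        ih hl.2 (fun t ht => hf t (List.mem_cons_of_mem _ ht))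
          (fun t ht => hg t (List.mem_cons_of_mem _ ht))
          (fun t ht => hg' t (List.mem_cons_of_mem _ ht))
          (fun h => hk (List.mem_cons_of_mem _ h)), mul_neg]

/-- The cycle product of `σ` at `t`, replaced by its real part if `t ∈ T`. -/
def partialRe (T : Finset (Fin n)) (σ : Perm (Fin n)) (t : Fin n) : SplitQuaternion :=
  if t ∈ T then ((rowCycleProd A σ t).re : SplitQuaternion) else rowCycleProd A σ t

theorem sum_partialRe_insert (hA : A.IsHermitian) (i k : Fin n) {T : Finset (Fin n)}
    (hk : k ∉ T) :
    ∑ σ : Perm (Fin n), ((Perm.sign σ : ℤ) : SplitQuaternion) *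
        ((cycleReps i σ).map (partialRe A (insert k T) σ)).prod =
      ∑ σ : Perm (Fin n), ((Perm.sign σ : ℤ) : SplitQuaternion) *
        ((cycleReps i σ).map (partialRe A T σ)).prod := by
  rw [← sub_eq_zero, ← Finset.sum_sub_distrib]
  refine sum_perm_eq_zero_of_invCycle k fun σ => ?_
  rw [sign_invCycle, cycleReps_invCycle, ← mul_sub, ← mul_sub, ← mul_neg]
  congr 1
  have hins (τ : Perm (Fin n)) (t : Fin n) (ht : t ≠ k) :
      partialRe A (insert k T) τ t = partialRe A T τ t := by
    simp [partialRe, ht]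
  have hinv (t : Fin n) (hkm : k ∈ cycleReps i σ) (htm : t ∈ cycleReps i σ) (ht : t ≠ k) :
      partialRe A T (invCycle k σ) t = partialRe A T σ t := by
    have hkt : ¬ σ.SameCycle k t := fun h => ht (eq_of_mem_cycleReps hkm htm h).symm
    rw [partialRe, partialRe,
      rowCycleProd_congr A (invCycle_pow_apply_of_not_sameCycle hkt)]
  by_cases hkm : k ∈ cycleReps i σ
  · refine list_prod_map_sub_eq_neg (nodup_cycleReps i σ) (k := k)
      (fun t _ ht => (hins σ t ht).symm) (fun t htm ht => ?_) (fun t htm ht => ?_) fun _ => ?_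
    · rw [hins _ t ht, hins _ t ht, hinv t hkm htm ht]
    · rw [hins _ t ht, hinv t hkm htm ht]
    · simp only [partialRe, Finset.mem_insert_self, if_true, hk, if_false,
        rowCycleProd_invCycle_self A hA]
      ext <;> simp
  · have hne (t : Fin n) (ht : t ∈ cycleReps i σ) : t ≠ k := by rintro rfl; exact hkm ht
    rw [List.map_congr_left fun t ht => hins σ t (hne t ht),
      List.map_congr_left fun t ht => hins (invCycle k σ) t (hne t ht)]
    simp

theorem rdet_eq_sum_cycleReProd (hA : A.IsHermitian) (i : Fin n) :
    rdet A i = algebraMap ℝ SplitQuaternion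
      (∑ σ : Perm (Fin n), ((Perm.sign σ : ℤ) : ℝ) * cycleReProd A σ) := by
  have hT (T : Finset (Fin n)) :
      rdet A i = ∑ σ : Perm (Fin n), ((Perm.sign σ : ℤ) : SplitQuaternion) *
        ((cycleReps i σ).map (partialRe A T σ)).prod := by
    induction T using Finset.induction_on with
    | empty =>
      have h₁ (σ : Perm (Fin n)) : partialRe A ∅ σ = rowCycleProd A σ := by
        funext t
        simp [partialRe]
      simp only [h₁, cycleReps, List.map_cons, List.prod_cons, rdet]
    | insert k T hk ih => rw [sum_partialRe_insert A hA i k hk, ih]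
  have hre (σ : Perm (Fin n)) : ((cycleReps i σ).map (partialRe A Finset.univ σ)).prod =
      algebraMap ℝ SplitQuaternion (cycleReProd A σ) := by
    classical
    have h₁ : partialRe A Finset.univ σ =
        algebraMap ℝ SplitQuaternion ∘ fun t => (rowCycleProd A σ t).re := by
      funext t
      simp [partialRe]
    rw [h₁, ← List.map_map, ← map_list_prod, cycleReProd_eq_mul A σ i, cycleReps, List.map_cons,
      List.prod_cons, ← List.prod_toFinset _ (nodup_otherCycleMins i σ)]
    congr 3
    ext t
    simp [mem_otherCycleMins]
  rw [hT Finset.univ, map_sum]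
  refine Finset.sum_congr rfl fun σ _ => ?_
  rw [hre, map_mul, map_intCast]

theorem re_star_mul_re_sub (x y : SplitQuaternion) :
    (star x).re * y.re - (y * star x).re = -(x.re * y.re - (y * x).re) := by
  simp; ring

theorem cycleReProd_sub_invCycle (hA : A.IsHermitian) {i j : Fin n}
    (hrow : ∀ q, A i q = A j q) {σ : Perm (Fin n)} (h : ¬ σ.SameCycle i j) :
    cycleReProd A (invCycle i σ) - cycleReProd A (invCycle i σ * swap i j) =
      -(cycleReProd A σ - cycleReProd A (σ * swap i j)) := by
  classical
  let rest (τ : Perm (Fin n)) : ℝ :=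
    ∏ t ∈ cycleMins τ with ¬ τ.SameCycle i t ∧ ¬ τ.SameCycle j t, (rowCycleProd A τ t).re
  have hsplit (τ : Perm (Fin n)) (hτ : ¬ τ.SameCycle i j) :
      cycleReProd A τ - cycleReProd A (τ * swap i j) =
        ((rowCycleProd A τ i).re * (rowCycleProd A τ j).re -
          (rowCycleProd A τ j * rowCycleProd A τ i).re) * rest τ := by
    have h₁ : cycleReProd A τ =
        (rowCycleProd A τ i).re * ((rowCycleProd A τ j).re * rest τ) := by
      rw [cycleReProd_eq_mul A τ i]
      congr 1
      convert! prod_cycleMins_filter (fun s t h => re_rowCycleProd_of_sameCycle A h)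
        (Q := fun t => ¬ τ.SameCycle i t) (fun s t hst hs hit => hs (hit.trans hst.symm)) hτ
    have h₂ : cycleReProd A (τ * swap i j) =
        (rowCycleProd A τ j * rowCycleProd A τ i).re * rest τ := by
      rw [cycleReProd_eq_mul A _ i, rowCycleProd_mul_swap A hrow hτ]
      congr 1
      refine Finset.prod_congr ?_ fun t ht => ?_
      · ext t
        simp only [Finset.mem_filter, mul_swap_sameCycle_iff hτ, not_or, mem_cycleMins]
        refine and_congr_left fun ht => forall_congr' fun x => ?_
        rw [sameCycle_iff_of_forall_pow_apply_eq
          (mul_swap_pow_apply_of_not_sameCycle_of_not_sameCycle ht.1 ht.2)]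
      · simp only [Finset.mem_filter] at ht
        rw [rowCycleProd_congr A
          (mul_swap_pow_apply_of_not_sameCycle_of_not_sameCycle ht.2.1 ht.2.2)]
    rw [h₁, h₂]
    ring
  have hrest : rest (invCycle i σ) = rest σ := by
    refine Finset.prod_congr ?_ fun t ht => ?_
    · ext t
      simp only [Finset.mem_filter, mem_cycleMins, invCycle_sameCycle_iff]
    · simp only [Finset.mem_filter] at ht
      rw [rowCycleProd_congr A (invCycle_pow_apply_of_not_sameCycle ht.2.1)]
  rw [hsplit σ h, hsplit _ (mt (invCycle_sameCycle_iff σ i i j).1 h), hrest,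
    rowCycleProd_invCycle_self A hA,
    rowCycleProd_congr A (invCycle_pow_apply_of_not_sameCycle h), re_star_mul_re_sub, neg_mul]

theorem sum_cycleReProd_eq_zero (hA : A.IsHermitian) {i j : Fin n} (hij : i ≠ j)
    (hrow : ∀ q, A i q = A j q) :
    ∑ σ : Perm (Fin n), ((Perm.sign σ : ℤ) : ℝ) * cycleReProd A σ = 0 := by
  classical
  have hsame : ∑ σ : Perm (Fin n) with σ.SameCycle i j,
        ((Perm.sign σ : ℤ) : ℝ) * cycleReProd A σ =
      ∑ σ : Perm (Fin n) with ¬ σ.SameCycle i j,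
        -(((Perm.sign σ : ℤ) : ℝ) * cycleReProd A (σ * swap i j)) := by
    refine Finset.sum_nbij' (· * swap i j) (· * swap i j) ?_ ?_ ?_ ?_ ?_
    · intro σ hσ
      simpa using not_mul_swap_sameCycle_of_sameCycle hij (Finset.mem_filter.1 hσ).2
    · intro σ hσ
      simpa using mul_swap_sameCycle_of_not_sameCycle (Finset.mem_filter.1 hσ).2
    · intro σ _; simp [mul_assoc]
    · intro σ _; simp [mul_assoc]
    · intro σ _; simp [mul_assoc, Perm.sign_swap hij]
  rw [← Finset.sum_filter_add_sum_filter_not Finset.univ (fun σ => Perm.SameCycle σ i j), hsame,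
    ← Finset.sum_add_distrib, Finset.sum_filter]
  refine sum_perm_eq_zero_of_invCycle i fun σ => ?_
  simp only [invCycle_sameCycle_iff, sign_invCycle]
  split_ifs with h
  · simp
  · rw [neg_add_eq_sub, neg_add_eq_sub, ← mul_sub, ← mul_sub,
      cycleReProd_sub_invCycle A hA hrow h, mul_neg]

end RealPart

/-- If a Hermitian matrix `A` has two identical rows or two identical columns,
then `det A = 0`. -/
theorem hdet_eq_zero_of_two_equal_rows_or_cols [NeZero n]
    (A : Matrix (Fin n) (Fin n) SplitQuaternion) (hA : A.IsHermitian)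
    (h : (∃ i j : Fin n, i ≠ j ∧ ∀ q, A i q = A j q) ∨
         (∃ i j : Fin n, i ≠ j ∧ ∀ p, A p i = A p j)) :
    hdet A = 0 := by
  obtain ⟨i, j, hij, hrow⟩ : ∃ i j : Fin n, i ≠ j ∧ ∀ q, A i q = A j q := by
    rcases h with h | ⟨i, j, hij, hcol⟩
    · exact h
    · exact ⟨i, j, hij, fun q => by rw [← hA.apply i q, ← hA.apply j q, hcol q]⟩
  rw [hdet, rdet_eq_sum_cycleReProd A hA, sum_cycleReProd_eq_zero A hA hij hrow, map_zero]

end SplitQuaternion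

end
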